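/- For every integer k ≥ 6, every prime power q with q ≥ k−2, and every integer s with 1 ≤ s ≤ q−1, there exists a [2q^{k−1} − q^{k−2} + 1 + (k−5)·θ_{k−1} − s(q+1), k, (k−3)q^{k−1} − 3q^{k−2} + q^{k−3} − sq]_q linear code, where θ_{k−1} = (q^k − 1)/(q − 1). -/

import Mathlib

/-- `C` is an `[n, k, d]_q` linear code over `F`: a `k`-dimensional `F`-linear subspace of
`F^n` such that the minimum Hamming weight of a nonzero codeword equals `d`. -/
def IsLinearCodeWith (F : Type) [Field F] [DecidableEq F] (n k d : ℕ)
    (C : Submodule F (Fin n → F)) : Prop :=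
  Module.finrank F C = k ∧
  (∀ c ∈ C, c ≠ 0 → d ≤ hammingNorm c) ∧
  (∃ c ∈ C, c ≠ 0 ∧ hammingNorm c = d)

open scoped LinearAlgebra.Projectivization in
lemma proj_sum {F V : Type*} [Field F] [Fintype F] [AddCommGroup V] [Module F V] [Fintype V]
    [Fintype (ℙ F V)] [DecidableEq V]
    (g : V → ℕ) (hg : ∀ (c : F) (v : V), c ≠ 0 → g (c • v) = g v) :
    (Fintype.card F - 1) * ∑ p : ℙ F V, g p.rep = ∑ v : V with v ≠ 0, g v := by
  classical
  let e : ℙ F V × Fˣ → {v : V // v ≠ 0} := fun x =>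
    ⟨(x.2 : F) • x.1.rep, smul_ne_zero x.2.ne_zero x.1.rep_nonzero⟩
  have he : Function.Bijective e := by
    constructor
    · rintro ⟨p, c⟩ ⟨p', c'⟩ h
      have h1 : (c : F) • p.rep = (c' : F) • p'.rep := congrArg Subtype.val h
      have hp : p = p' := by
        rw [← p.mk_rep, ← p'.mk_rep, Projectivization.mk_eq_mk_iff']
        refine ⟨(c : F)⁻¹ * c', ?_⟩
        rw [mul_smul, ← h1, smul_smul, inv_mul_cancel₀ c.ne_zero, one_smul]
      subst hp
      have h2 : (c : F) = c' := smul_left_injective F p.rep_nonzero h1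
      rw [Units.ext h2]
    · rintro ⟨v, hv⟩
      obtain ⟨a, ha⟩ := Projectivization.exists_smul_eq_mk_rep F v hv
      refine ⟨(Projectivization.mk F v hv, a⁻¹), ?_⟩
      apply Subtype.ext
      change ((a⁻¹ : Fˣ) : F) • (Projectivization.mk F v hv).rep = v
      rw [← ha, ← Units.smul_def, inv_smul_smul]
  have h1 : ∑ v : V with v ≠ 0, g v = ∑ v : {v : V // v ≠ 0}, g v := by
    rw [← Finset.sum_subtype_eq_sum_filter]
    apply Finset.sum_congr <;> simp
  rw [h1, ← (Equiv.ofBijective e he).sum_comp, Fintype.sum_prod_type, Finset.mul_sum]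
  apply Finset.sum_congr rfl
  intro p _
  have : ∀ c : Fˣ, g ((Equiv.ofBijective e he) (p, c)) = g p.rep := fun c =>
    hg c p.rep c.ne_zero
  rw [Finset.sum_congr rfl (fun c _ => this c), Finset.sum_const, Finset.card_univ,
    Fintype.card_units, smul_eq_mul]

lemma card_nz {F V : Type*} [Field F] [Fintype F] [DecidableEq F] [AddCommGroup V] [Module F V]
    [Fintype V] (φ : V →ₗ[F] F) (h : φ ≠ 0) :
    Fintype.card {v : V // φ v ≠ 0} =
      (Fintype.card F - 1) * Fintype.card F ^ (Module.finrank F V - 1) := by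
  classical
  have h1 : Fintype.card {v : V // φ v ≠ 0} + Fintype.card {v : V // φ v = 0}
      = Fintype.card V := by
    have := Fintype.card_subtype_compl (fun v : V => φ v = 0)
    have h2 := Fintype.card_subtype_le (fun v : V => φ v = 0)
    change Fintype.card {v : V // ¬ φ v = 0} + _ = _
    omega
  have h2 : Fintype.card {v : V // φ v = 0} =
      Fintype.card F ^ (Module.finrank F (LinearMap.ker φ)) := by
    rw [← Module.card_eq_pow_finrank (K := F) (V := LinearMap.ker φ)]
    exact Fintype.card_congr (Equiv.refl _)
  have h3 := Module.Dual.finrank_ker_add_one_of_ne_zero (f := φ) h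
  rw [h2, Module.card_eq_pow_finrank (K := F) (V := V)] at h1
  rw [← h3] at h1 ⊢
  have hq : 1 ≤ Fintype.card F := Fintype.card_pos
  obtain ⟨r, hr⟩ := Nat.exists_eq_add_of_le hq
  rw [hr] at h1 ⊢
  simp only [Nat.add_sub_cancel, Nat.add_sub_cancel_left] at h1 ⊢
  rw [pow_succ] at h1
  nlinarith

open scoped LinearAlgebra.Projectivization in
lemma code_of_family {F V ι : Type} [Field F] [Fintype F] [DecidableEq F]
    [AddCommGroup V] [Module F V] [FiniteDimensional F V] [Fintype ι]
    (q k m n d : ℕ) (hF : Fintype.card F = q) (hV : Module.finrank F V = k)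
    (U : ι → Submodule F V) (u : ι → ℕ) (hu : ∀ i, Module.finrank F (U i) = u i)
    (hits : ∀ v : V, v ≠ 0 → Nat.card {i // v ∈ U i} ≤ m)
    (φ₀ : V →ₗ[F] F) (hφ₀ : ∀ i, ∃ v ∈ U i, φ₀ v ≠ 0) (hφ : φ₀ ≠ 0)
    (hn : (q - 1) * n + ∑ i, (q ^ u i - 1) = m * (q ^ k - 1))
    (hd : d + ∑ i, q ^ (u i - 1) = m * q ^ (k - 1)) (hd0 : 0 < d) :
    ∃ C : Submodule F (Fin n → F), IsLinearCodeWith F n k d C := by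
  classical
  have : Finite V := Module.finite_of_finite F
  have : Fintype V := Fintype.ofFinite V
  have : Fintype (ℙ F V) := Fintype.ofFinite _
  have hq1 : 1 < q := hF ▸ Fintype.one_lt_card
  have hq0 : 0 < q - 1 := by omega
  let hit : V → ℕ := fun v => ∑ i, if v ∈ U i then 1 else 0
  have hhit : ∀ v, v ≠ 0 → hit v ≤ m := by
    intro v hv
    have := hits v hv
    rw [Nat.card_eq_fintype_card, Fintype.card_subtype] at this
    simpa [hit] using this
  have hhs : ∀ (c : F) (v : V), c ≠ 0 → hit (c • v) = hit v := by
    intro c v hc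
    simp only [hit]
    apply Finset.sum_congr rfl
    intro i _
    rw [Submodule.smul_mem_iff _ hc]
  let mu : V → ℕ := fun v => m - hit v
  have hmu : ∀ v, v ≠ 0 → mu v + hit v = m := fun v hv => Nat.sub_add_cancel (hhit v hv)
  -- master count
  have key : ∀ (R : V → Prop) [DecidablePred R], (∀ (c : F) (v : V), c ≠ 0 → (R (c • v) ↔ R v)) →
      (q - 1) * (∑ p : ℙ F V, if R p.rep then mu p.rep else 0)
        + ∑ i, Fintype.card {v : V // v ∈ U i ∧ v ≠ 0 ∧ R v}
        = m * Fintype.card {v : V // v ≠ 0 ∧ R v} := by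
    intro R _ hR
    have h1 := proj_sum (F := F) (fun v : V => if R v then mu v else 0) (by
      intro c v hc
      simp only [hR c v hc, mu, hhs c v hc])
    rw [hF] at h1
    rw [h1]
    have h2 : ∀ i, Fintype.card {v : V // v ∈ U i ∧ v ≠ 0 ∧ R v} =
        ∑ v : V with v ≠ 0, if R v then (if v ∈ U i then 1 else 0) else 0 := by
      intro i
      rw [Fintype.card_subtype, Finset.card_filter, Finset.sum_filter]
      apply Finset.sum_congr rfl
      intro v _
      by_cases h1 : v ∈ U i <;> by_cases h2 : v = 0 <;> by_cases h3 : R v <;> simp [h1, h2, h3]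
    have h3 : m * Fintype.card {v : V // v ≠ 0 ∧ R v} =
        ∑ v : V with v ≠ 0, if R v then m else 0 := by
      rw [Fintype.card_subtype, Finset.card_filter, Finset.sum_filter, Finset.mul_sum]
      apply Finset.sum_congr rfl
      intro v _
      by_cases h2 : v = 0 <;> by_cases h3 : R v <;> simp [h2, h3]
    rw [h3, Finset.sum_congr rfl (fun i _ => h2 i), Finset.sum_comm, ← Finset.sum_add_distrib]
    apply Finset.sum_congr rfl
    intro v hv
    have hv' : v ≠ 0 := by simpa using hv
    by_cases h : R v
    · simp only [h, if_true]
      exact hmu v hv'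
    · simp [h]
  -- length
  have hlen : ∑ p : ℙ F V, mu p.rep = n := by
    have h := key (fun _ => True) (by simp)
    have h1 : ∀ i, Fintype.card {v : V // v ∈ U i ∧ v ≠ 0 ∧ True} = q ^ u i - 1 := by
      intro i
      have e : {v : V // v ∈ U i ∧ v ≠ 0 ∧ True} ≃ {v : U i // v ≠ 0} :=
        { toFun := fun v => ⟨⟨v.1, v.2.1⟩, fun h => v.2.2.1 (congrArg Subtype.val h)⟩
          invFun := fun v => ⟨v.1.1, v.1.2, fun h => v.2 (Subtype.ext h), trivial⟩
          left_inv := fun _ => rfl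
          right_inv := fun _ => rfl }
      rw [Fintype.card_congr e, Fintype.card_subtype_compl, Fintype.card_subtype_eq,
        Module.card_eq_pow_finrank (K := F), hF, hu]
    have h2 : Fintype.card {v : V // v ≠ 0 ∧ True} = q ^ k - 1 := by
      have e : {v : V // v ≠ 0 ∧ True} ≃ {v : V // v ≠ 0} := Equiv.subtypeEquivRight (by simp)
      rw [Fintype.card_congr e, Fintype.card_subtype_compl, Fintype.card_subtype_eq,
        Module.card_eq_pow_finrank (K := F), hF, hV]
    rw [Finset.sum_congr rfl (fun i _ => h1 i), h2, ← hn] at h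
    have h3 := Nat.add_right_cancel h
    simpa using Nat.eq_of_mul_eq_mul_left hq0 h3
  -- weights
  let wt : (V →ₗ[F] F) → ℕ := fun φ => ∑ p : ℙ F V, if φ p.rep ≠ 0 then mu p.rep else 0
  have hkey2 : ∀ φ : V →ₗ[F] F, φ ≠ 0 →
      (q - 1) * wt φ + ∑ i, Fintype.card {v : V // v ∈ U i ∧ v ≠ 0 ∧ φ v ≠ 0}
        = (q - 1) * (m * q ^ (k - 1)) := by
    intro φ hφ
    have h := key (fun v => φ v ≠ 0) (by intro c v hc; simp [hc])
    have h2 : Fintype.card {v : V // v ≠ 0 ∧ φ v ≠ 0} = (q - 1) * q ^ (k - 1) := by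
      have e : {v : V // v ≠ 0 ∧ φ v ≠ 0} ≃ {v : V // φ v ≠ 0} :=
        Equiv.subtypeEquivRight (by
          intro v
          constructor
          · exact fun h => h.2
          · exact fun h => ⟨fun h0 => h (by simp [h0]), h⟩)
      rw [Fintype.card_congr e, card_nz φ hφ, hF, hV]
    rw [h2] at h
    simp only [wt]
    rw [h]; ring
  have hUeq : ∀ (φ : V →ₗ[F] F) i, (∃ v ∈ U i, φ v ≠ 0) →
      Fintype.card {v : V // v ∈ U i ∧ v ≠ 0 ∧ φ v ≠ 0} = (q - 1) * q ^ (u i - 1) := by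
    intro φ i ⟨w, hw, hw'⟩
    have e : {v : V // v ∈ U i ∧ v ≠ 0 ∧ φ v ≠ 0} ≃ {v : U i // (φ.domRestrict (U i)) v ≠ 0} :=
        { toFun := fun v => ⟨⟨v.1, v.2.1⟩, v.2.2.2⟩
          invFun := fun v => ⟨v.1.1, v.1.2, fun h => v.2 (by simp [h]), v.2⟩
          left_inv := fun _ => rfl
          right_inv := fun _ => rfl }
    rw [Fintype.card_congr e, card_nz, hF, hu]
    intro h
    exact hw' (by simpa using LinearMap.congr_fun h ⟨w, hw⟩)
  have hUle : ∀ (φ : V →ₗ[F] F) i,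
      Fintype.card {v : V // v ∈ U i ∧ v ≠ 0 ∧ φ v ≠ 0} ≤ (q - 1) * q ^ (u i - 1) := by
    intro φ i
    by_cases h : ∃ v ∈ U i, φ v ≠ 0
    · exact (hUeq φ i h).le
    · have : IsEmpty {v : V // v ∈ U i ∧ v ≠ 0 ∧ φ v ≠ 0} := ⟨fun v => h ⟨v.1, v.2.1, v.2.2.2⟩⟩
      simp
  have hwle : ∀ φ : V →ₗ[F] F, φ ≠ 0 → d ≤ wt φ := by
    intro φ hφ
    have h1 := hkey2 φ hφ
    have h2 : ∑ i, Fintype.card {v : V // v ∈ U i ∧ v ≠ 0 ∧ φ v ≠ 0} ≤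
        (q - 1) * ∑ i, q ^ (u i - 1) := by
      rw [Finset.mul_sum]
      exact Finset.sum_le_sum (fun i _ => hUle φ i)
    rw [← hd] at h1
    have h3 : (q - 1) * d ≤ (q - 1) * wt φ := by
      rw [mul_add] at h1
      omega
    exact Nat.le_of_mul_le_mul_left h3 hq0
  have hweq : wt φ₀ = d := by
    have h1 := hkey2 φ₀ hφ
    have h2 : ∑ i, Fintype.card {v : V // v ∈ U i ∧ v ≠ 0 ∧ φ₀ v ≠ 0} =
        (q - 1) * ∑ i, q ^ (u i - 1) := by
      rw [Finset.mul_sum]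
      exact Finset.sum_congr rfl (fun i _ => hUeq φ₀ i (hφ₀ i))
    rw [← hd, h2, ← mul_add] at h1
    have := Nat.eq_of_mul_eq_mul_left hq0 h1
    omega
  -- the code
  have hcard : Fintype.card (Σ p : ℙ F V, Fin (mu p.rep)) = n := by
    simp [hlen]
  let e : Fin n ≃ (Σ p : ℙ F V, Fin (mu p.rep)) := (Fintype.equivFinOfCardEq hcard).symm
  let E : (V →ₗ[F] F) →ₗ[F] (Fin n → F) :=
    { toFun := fun φ j => φ (e j).1.rep
      map_add' := fun _ _ => rfl
      map_smul' := fun _ _ => rfl }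
  have hE : ∀ φ, hammingNorm (E φ) = wt φ := by
    intro φ
    have h1 : hammingNorm (E φ) = ∑ j : Fin n, if φ (e j).1.rep ≠ 0 then 1 else 0 := by
      rw [← Finset.card_filter]; rfl
    rw [h1, e.sum_comp (fun x => if φ x.1.rep ≠ 0 then 1 else 0), Fintype.sum_sigma]
    apply Finset.sum_congr rfl
    intro p _
    split_ifs <;> simp
  have hEinj : Function.Injective E := by
    rw [← LinearMap.ker_eq_bot, LinearMap.ker_eq_bot']
    intro φ h
    by_contra hne
    have h1 := hwle φ hne
    rw [← hE, h] at h1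
    simp at h1
    omega
  refine ⟨LinearMap.range E, ?_, ?_, ?_⟩
  · rw [LinearMap.finrank_range_of_inj hEinj]
    rw [← hV]
    exact Subspace.dual_finrank_eq
  · rintro c ⟨φ, rfl⟩ hc
    rw [hE]
    exact hwle φ (fun h => hc (by rw [h, map_zero]))
  · refine ⟨E φ₀, ⟨φ₀, rfl⟩, ?_, ?_⟩
    · intro h
      exact hφ (hEinj (by rw [h, map_zero]))
    · rw [hE, hweq]

open Polynomial in
lemma deg_bound {F : Type} [Field F] (f : F[X]) (hf : f ≠ 0) (e : ℕ) (he : X ^ e ∣ f)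
    (D : Finset Fˣ) (hD : ∀ a ∈ D, (X - C (a : F)) ^ 2 ∣ f) (Q : F[X]) (hQ : Q ∣ f)
    (hQ' : ∀ a, Q.eval a ≠ 0) : e + 2 * D.card + Q.natDegree ≤ f.natDegree := by
  have cQ : ∀ a : F, IsCoprime (X - C a) Q := by
    intro a
    rw [(irreducible_X_sub_C a).coprime_iff_not_dvd, dvd_iff_isRoot]
    exact hQ' a
  have cX : ∀ a : Fˣ, IsCoprime (X : F[X]) (X - C (a : F)) := by
    intro a
    have := isCoprime_X_sub_C_of_isUnit_sub (a := (0 : F)) (b := (a : F)) (by simp)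
    simpa using this
  have h1 : ∏ a ∈ D, (X - C (a : F)) ^ 2 ∣ f := by
    apply Finset.prod_dvd_of_coprime
    · intro a _ b _ hab
      apply IsCoprime.pow
      apply isCoprime_X_sub_C_of_isUnit_sub
      rw [isUnit_iff_ne_zero, sub_ne_zero]
      exact fun h => hab (Units.ext h)
    · exact hD
  have h2 : X ^ e * ∏ a ∈ D, (X - C (a : F)) ^ 2 ∣ f := by
    apply IsCoprime.mul_dvd _ he h1
    apply IsCoprime.prod_right
    intro a _
    exact (cX a).pow
  have h3 : (X ^ e * ∏ a ∈ D, (X - C (a : F)) ^ 2) * Q ∣ f := by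
    apply IsCoprime.mul_dvd _ h2 hQ
    apply IsCoprime.mul_left
    · apply IsCoprime.pow_left
      simpa using cQ 0
    · apply IsCoprime.prod_left
      intro a _
      exact (cQ a).pow_left
  have hQ0 : Q ≠ 0 := fun h => hQ' 0 (by simp [h])
  have hm1 : (X ^ e : F[X]).Monic := monic_X_pow e
  have hm2 : (∏ a ∈ D, (X - C (a : F)) ^ 2).Monic :=
    monic_prod_of_monic _ _ (fun a _ => (monic_X_sub_C _).pow 2)
  have h4 := natDegree_le_of_dvd h3 hf
  rw [natDegree_mul (hm1.mul hm2).ne_zero hQ0, hm1.natDegree_mul hm2,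
    natDegree_prod_of_monic _ _ (fun a _ => (monic_X_sub_C _).pow 2)] at h4
  simp only [natDegree_pow, natDegree_X, natDegree_X_sub_C, Finset.sum_const,
    smul_eq_mul] at h4
  omega

open Polynomial in
/-- multiplication by `A` as a map of bounded degree polynomials -/
noncomputable def mulMap {F : Type} [Field F] (A : F[X]) (r k : ℕ) (h : A.natDegree + r ≤ k) :
    degreeLT F r →ₗ[F] degreeLT F k :=
  LinearMap.codRestrict (degreeLT F k)
    ((LinearMap.mulLeft F A).comp (degreeLT F r).subtype) (by
      rintro ⟨g, hg⟩
      rw [mem_degreeLT] at hg ⊢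
      by_cases hA : A = 0
      · simp [hA]
      by_cases hg0 : g = 0
      · simp [hg0]
      change degree (A * g) < k
      rw [degree_mul, degree_eq_natDegree hA, degree_eq_natDegree hg0]
      rw [degree_eq_natDegree hg0] at hg
      norm_cast at hg ⊢
      omega)

open Polynomial in
lemma mulMap_apply {F : Type} [Field F] (A : F[X]) (r k : ℕ) (h : A.natDegree + r ≤ k)
    (g : degreeLT F r) : ((mulMap A r k h g : degreeLT F k) : F[X]) = A * (g : F[X]) := rfl

open Polynomial in
lemma finrank_degreeLT' {F : Type} [Field F] (r : ℕ) :
    Module.finrank F (degreeLT F r) = r := by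
  rw [(degreeLTEquiv F r).finrank_eq]; simp

open Polynomial in
lemma finrank_mulMap {F : Type} [Field F] (A : F[X]) (hA : A ≠ 0) (r k : ℕ)
    (h : A.natDegree + r ≤ k) :
    Module.finrank F (LinearMap.range (mulMap A r k h)) = r := by
  rw [LinearMap.finrank_range_of_inj, finrank_degreeLT']
  intro a b hab
  have := congrArg (Subtype.val) hab
  rw [mulMap_apply, mulMap_apply] at this
  exact Subtype.ext (mul_left_cancel₀ hA this)

open Polynomial in
lemma exists_P {F : Type} [Field F] [Fintype F] :
    ∃ P : F[X], P.natDegree = 2 ∧ ∀ a, P.eval a ≠ 0 := by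
  have h : ¬ Function.Surjective (fun x : F => x * x - x) := by
    intro hs
    have hi := Finite.injective_iff_surjective.mpr hs
    exact zero_ne_one (hi (a₁ := (0 : F)) (a₂ := 1) (by simp))
  simp only [Function.Surjective, not_forall, not_exists] at h
  obtain ⟨c, hc⟩ := h
  refine ⟨X ^ 2 - X - C c, ?_, ?_⟩
  · compute_degree!
  · intro a ha
    apply hc a
    simp at ha
    linear_combination ha

open Polynomial in
/-- the multipliers -/
noncomputable def fam {F : Type} [Field F] (P : F[X]) {s : ℕ} (γ : Fin s → F) :
    Bool ⊕ (Fˣ ⊕ Fin s) → F[X]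
  | .inl false => X
  | .inl true => 1
  | .inr (.inl a) => (X - C (a : F)) ^ 2
  | .inr (.inr j) => P * (1 + C (γ j) * X ^ 2)

/-- the dimensions -/
def famr {F : Type} [Field F] (k s : ℕ) : Bool ⊕ (Fˣ ⊕ Fin s) → ℕ
  | .inl _ => k - 1
  | .inr (.inl _) => k - 2
  | .inr (.inr _) => 2

open Polynomial in
lemma fam_deg {F : Type} [Field F] (P : F[X]) (hP : P.natDegree = 2) {s : ℕ} (γ : Fin s → F)
    (k : ℕ) (hk : 6 ≤ k) (i : Bool ⊕ (Fˣ ⊕ Fin s)) :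
    (fam P γ i).natDegree + famr (F := F) k s i ≤ k := by
  rcases i with (_ | _) | a | j
  · simp [fam, famr]; omega
  · simp [fam, famr]
  · simp [fam, famr]; omega
  · have h1 : (1 + C (γ j) * X ^ 2 : F[X]).natDegree ≤ 2 := by compute_degree
    have h2 := natDegree_mul_le (p := P) (q := 1 + C (γ j) * X ^ 2)
    simp only [fam, famr]
    omega

open Polynomial in
lemma line_ne {F : Type} [Field F] (c : F) : (1 + C c * X ^ 2 : F[X]) ≠ 0 := by
  intro h
  have := congrArg (eval 0) h
  simp at this

open Polynomial in
lemma fam_ne {F : Type} [Field F] (P : F[X]) (hP : P ≠ 0) {s : ℕ} (γ : Fin s → F)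
    (i : Bool ⊕ (Fˣ ⊕ Fin s)) : fam P γ i ≠ 0 := by
  rcases i with (_ | _) | a | j
  · simp [fam]
  · simp [fam]
  · exact pow_ne_zero _ (X_sub_C_ne_zero _)
  · exact mul_ne_zero hP (line_ne _)

open Polynomial in
lemma lines_disj {F : Type} [Field F] (c c' : F) (g g' : F[X]) (hg : g ∈ degreeLT F 2)
    (hg' : g' ∈ degreeLT F 2) (h0 : g ≠ 0)
    (h : (1 + C c * X ^ 2) * g = (1 + C c' * X ^ 2) * g') : c = c' := by
  have hz : ∀ g ∈ degreeLT F 2, ∀ n, 2 ≤ n → coeff g n = 0 := by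
    intro g hg n hn
    rw [mem_degreeLT] at hg
    apply coeff_eq_zero_of_degree_lt
    exact lt_of_lt_of_le hg (by exact_mod_cast hn)
  have key : ∀ (c : F) (g : F[X]) n, ((1 + C c * X ^ 2) * g).coeff (n + 2)
      = g.coeff (n + 2) + c * g.coeff n := by
    intro c g n
    rw [add_mul, one_mul, coeff_add, mul_assoc, coeff_C_mul, coeff_X_pow_mul]
  have key' : ∀ (c : F) (g : F[X]) n, n < 2 → ((1 + C c * X ^ 2) * g).coeff n
      = g.coeff n := by
    intro c g n hn
    rw [add_mul, one_mul, coeff_add, mul_assoc, coeff_C_mul, coeff_X_pow_mul']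
    simp [hn]
  by_contra hc
  apply h0
  ext n
  rw [coeff_zero]
  by_cases hn : 2 ≤ n
  · exact hz g hg n hn
  · have e1 := congrArg (fun p => coeff p n) h
    have e2 := congrArg (fun p => coeff p (n + 2)) h
    simp only [key, key' _ _ n (by omega), hz g hg (n + 2) (by omega),
      hz g' hg' (n + 2) (by omega)] at e1 e2
    rw [← e1] at e2
    have : (c - c') * g.coeff n = 0 := by linear_combination e2
    rcases mul_eq_zero.mp this with h | h
    · exact absurd (sub_eq_zero.mp h) hc
    · exact h

open Polynomial in
lemma fam_hits {F : Type} [Field F] [Fintype F] (P : F[X]) (hP : P.natDegree = 2)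
    (hP' : ∀ a, P.eval a ≠ 0) {s : ℕ} (γ : Fin s → F) (hγ : Function.Injective γ)
    (k : ℕ) (hk : 6 ≤ k) (v : degreeLT F k) (hv : v ≠ 0) :
    Nat.card {i // v ∈ LinearMap.range (mulMap (fam P γ i) (famr (F := F) k s i) k
      (fam_deg P hP γ k hk i))} ≤ k - 3 := by
  classical
  have hv0 : (v : F[X]) ≠ 0 := fun h => hv (Subtype.ext h)
  have hdeg : (v : F[X]).natDegree < k := by
    have := mem_degreeLT.mp v.2
    rwa [degree_eq_natDegree hv0, Nat.cast_lt] at this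
  have hmem : ∀ i, v ∈ LinearMap.range (mulMap (fam P γ i) (famr (F := F) k s i) k
      (fam_deg P hP γ k hk i)) →
      ∃ g ∈ degreeLT F (famr (F := F) k s i), (v : F[X]) = fam P γ i * g := by
    rintro i ⟨g, hg⟩
    exact ⟨g, g.2, by rw [← hg, mulMap_apply]⟩
  set M : Bool ⊕ (Fˣ ⊕ Fin s) → Prop := fun i =>
    v ∈ LinearMap.range (mulMap (fam P γ i) (famr (F := F) k s i) k
      (fam_deg P hP γ k hk i)) with hM
  change Nat.card {i // M i} ≤ k - 3
  rw [Nat.card_eq_fintype_card, Fintype.card_subtype, Finset.card_filter,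
    Fintype.sum_sum_type, Fintype.sum_sum_type, Fintype.sum_bool]
  rw [← Finset.card_filter, ← Finset.card_filter]
  set D : Finset Fˣ := {a | M (.inr (.inl a))} with hD
  set L : Finset (Fin s) := {j | M (.inr (.inr j))} with hL
  have hL1 : L.card ≤ 1 := by
    rw [Finset.card_le_one]
    intro a ha b hb
    obtain ⟨g, hg, e⟩ := hmem _ (Finset.mem_filter.mp ha).2
    obtain ⟨g', hg', e'⟩ := hmem _ (Finset.mem_filter.mp hb).2
    apply hγ
    apply lines_disj (γ a) (γ b) g g' hg hg'
    · rintro rfl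
      exact hv0 (by simp [e])
    · have hPne : P ≠ 0 := fun h => hP' 0 (by simp [h])
      apply mul_left_cancel₀ hPne
      rw [← mul_assoc, ← mul_assoc]
      exact e.symm.trans e'
  have hDd : ∀ a ∈ D, (X - C (a : F)) ^ 2 ∣ (v : F[X]) := by
    intro a ha
    obtain ⟨g, hg, e⟩ := hmem _ (Finset.mem_filter.mp ha).2
    exact ⟨g, e⟩
  have hX : X ^ (if M (.inl false) then 1 else 0) ∣ (v : F[X]) := by
    split_ifs with h
    · obtain ⟨g, hg, e⟩ := hmem _ h
      exact ⟨g, by rw [pow_one]; exact e⟩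
    · simp
  have hI : (v : F[X]).natDegree + (if M (.inl true) then 1 else 0) ≤ k - 1 := by
    split_ifs with h
    · obtain ⟨g, hg, e⟩ := hmem _ h
      have e' : (v : F[X]) = g := by rw [e]; exact one_mul g
      rw [← e'] at hg
      have := mem_degreeLT.mp hg
      rw [degree_eq_natDegree hv0, Nat.cast_lt] at this
      change _ < k - 1 at this
      omega
    · omega
  have hbound : (if M (.inl false) then 1 else 0) + 2 * D.card + 2 * L.card
      ≤ (v : F[X]).natDegree := by
    rcases Finset.eq_empty_or_nonempty L with h | ⟨j, hj⟩
    · have := deg_bound (v : F[X]) hv0 _ hX D hDd 1 (one_dvd _) (by simp)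
      rw [h]
      simpa using this
    · obtain ⟨g, hg, e⟩ := hmem _ (Finset.mem_filter.mp hj).2
      have := deg_bound (v : F[X]) hv0 _ hX D hDd P
        ⟨(1 + C (γ j) * X ^ 2) * g, by rw [e, ← mul_assoc]; rfl⟩ hP'
      omega
  have h1 : (if M (.inl false) then 1 else 0) ≤ 1 := by split_ifs <;> simp
  have h2 : (if M (.inl true) then 1 else 0) ≤ 1 := by split_ifs <;> simp
  omega

open Polynomial in
lemma final_aux (k q s : ℕ) (hk : 6 ≤ k) (hq : 4 ≤ q)
    (hs2 : s ≤ q - 1)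
    (F : Type) [Field F] [Fintype F] [DecidableEq F] (hF : Fintype.card F = q) (n d : ℕ)
    (hn : (q - 1) * n + (2 * (q ^ (k - 1) - 1) + (q - 1) * (q ^ (k - 2) - 1) + s * (q ^ 2 - 1))
      = (k - 3) * (q ^ k - 1))
    (hd : d + (2 * q ^ (k - 2) + (q - 1) * q ^ (k - 3) + s * q) = (k - 3) * q ^ (k - 1))
    (hd0 : 0 < d) :
    ∃ C : Submodule F (Fin n → F), IsLinearCodeWith F n k d C := by
  classical
  obtain ⟨P, hP, hP'⟩ := exists_P (F := F)
  have hPne : P ≠ 0 := fun h => hP' 0 (by simp [h])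
  obtain ⟨γ⟩ : Nonempty (Fin s ↪ F) := by
    apply Function.Embedding.nonempty_of_card_le
    simp; omega
  have hfd : FiniteDimensional F (degreeLT F k) :=
    Module.Finite.equiv (degreeLTEquiv F k).symm
  let φ₀ : degreeLT F k →ₗ[F] F := (lcoeff F 1).comp (degreeLT F k).subtype
  have hφ₀ : ∀ i, ∃ v ∈ LinearMap.range (mulMap (fam P γ i) (famr (F := F) k s i) k
      (fam_deg P hP γ k hk i)), φ₀ v ≠ 0 := by
    have hh : ∀ i, (∃ g ∈ degreeLT F (famr (F := F) k s i), (fam P γ i * g).coeff 1 ≠ 0) →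
      ∃ v ∈ LinearMap.range (mulMap (fam P γ i) (famr (F := F) k s i) k
      (fam_deg P hP γ k hk i)), φ₀ v ≠ 0 := by
      rintro i ⟨g, hg, h⟩
      exact ⟨_, ⟨⟨g, hg⟩, rfl⟩, h⟩
    have hX : ∀ r : ℕ, 2 ≤ r → (X : F[X]) ∈ degreeLT F r := by
      intro r hr
      rw [mem_degreeLT, degree_X]
      exact_mod_cast hr
    intro i
    apply hh
    rcases i with (_ | _) | a | j
    · refine ⟨1, ?_, ?_⟩
      · rw [mem_degreeLT, degree_one]
        simp only [famr]
        exact_mod_cast (by omega : 0 < k - 1)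
      · simp [fam]
    · refine ⟨X, hX _ (by simp only [famr]; omega), ?_⟩
      simp [fam]
    · refine ⟨X, hX _ (by simp only [famr]; omega), ?_⟩
      rw [coeff_mul_X (n := 0), coeff_zero_eq_eval_zero]
      simp [fam]
    · refine ⟨X, hX _ (by simp only [famr]; omega), ?_⟩
      rw [coeff_mul_X (n := 0), coeff_zero_eq_eval_zero]
      simpa [fam] using hP' 0
  have hcu : Fintype.card Fˣ = q - 1 := by rw [Fintype.card_units, hF]
  refine code_of_family q k (k - 3) n d hF (finrank_degreeLT' k)
    (fun i => LinearMap.range (mulMap (fam P γ i) (famr (F := F) k s i) k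
      (fam_deg P hP γ k hk i))) (famr (F := F) k s)
    (fun i => finrank_mulMap _ (fam_ne P hPne γ i) _ _ _)
    (fun v hv => fam_hits P hP hP' γ γ.injective k hk v hv) φ₀ hφ₀ ?_ ?_ ?_ hd0
  · intro h
    obtain ⟨v, _, hv⟩ := hφ₀ (.inl false)
    exact hv (by rw [h]; rfl)
  · rw [← hn, Fintype.sum_sum_type, Fintype.sum_sum_type, Fintype.sum_bool]
    simp only [famr, Finset.sum_const, Finset.card_univ, hcu, Fintype.card_fin, smul_eq_mul]
    ring
  · rw [← hd, Fintype.sum_sum_type, Fintype.sum_sum_type, Fintype.sum_bool]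
    simp only [famr, Finset.sum_const, Finset.card_univ, hcu, Fintype.card_fin, smul_eq_mul,
      show k - 1 - 1 = k - 2 by omega, show k - 2 - 1 = k - 3 by omega]
    simp only [Nat.reduceSub, pow_one]
    ring

/-- For every integer `k ≥ 6`, every prime power `q ≥ k - 2` and every `s` with
`1 ≤ s ≤ q - 1`, there exists a
`[2q^{k-1} - q^{k-2} + 1 + (k-5)θ_{k-1} - s(q+1), k,
(k-3)q^{k-1} - 3q^{k-2} + q^{k-3} - sq]_q` code, where `θ_{k-1} = (q^k - 1)/(q - 1)`. -/
theorem statement10 (k q s : ℕ) (hk : 6 ≤ k) (hq : IsPrimePow q) (hkq : k - 2 ≤ q)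
    (hs1 : 1 ≤ s) (hs2 : s ≤ q - 1)
    (F : Type) [Field F] [Fintype F] [DecidableEq F] (hF : Fintype.card F = q) :
    ∃ C : Submodule F
        (Fin (2 * q ^ (k - 1) - q ^ (k - 2) + 1 + (k - 5) * ((q ^ k - 1) / (q - 1))
          - s * (q + 1)) → F),
      IsLinearCodeWith F
        (2 * q ^ (k - 1) - q ^ (k - 2) + 1 + (k - 5) * ((q ^ k - 1) / (q - 1)) - s * (q + 1)) k
        ((k - 3) * q ^ (k - 1) - 3 * q ^ (k - 2) + q ^ (k - 3) - s * q) C := by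

  have hq4 : 4 ≤ q := by omega
  obtain ⟨t, rfl⟩ : ∃ t, k = t + 6 := ⟨k - 6, by omega⟩
  obtain ⟨p, rfl⟩ : ∃ p, q = p + 1 := ⟨q - 1, by omega⟩
  set q := p + 1 with hqdef
  simp only [show t + 6 - 1 = t + 5 by omega, show t + 6 - 2 = t + 4 by omega,
    show t + 6 - 3 = t + 3 by omega]
  have hθ : q - 1 ∣ q ^ (t + 6) - 1 := by simpa using Nat.sub_dvd_pow_sub_pow q 1 (t + 6)
  obtain ⟨θ, hθ⟩ := hθ
  have hpq : q - 1 = p := by omega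
  have hp0 : 0 < p := by omega
  have hθ' : (q ^ (t + 6) - 1) / (q - 1) = θ := by
    rw [hθ]; exact Nat.mul_div_cancel_left _ (by omega)
  rw [hθ']
  have hQ1 : 1 ≤ q ^ t := Nat.one_le_pow _ _ (by omega)
  have e3 : q ^ (t + 3) = q ^ t * q ^ 3 := pow_add _ _ _
  have e4 : q ^ (t + 4) = q * q ^ (t + 3) := by ring
  have e5 : q ^ (t + 5) = q * q ^ (t + 4) := by ring
  have e6 : q ^ (t + 6) = q * q ^ (t + 5) := by ring
  have b3 : q ^ 3 ≤ q ^ (t + 3) := Nat.pow_le_pow_right (by omega) (by omega)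
  have bs : s * q < q ^ 3 := by
    have : s * q ≤ q * q := Nat.mul_le_mul_right _ (by omega)
    nlinarith
  have bs' : s * (q + 1) ≤ q ^ 3 := by
    have h1 : s * (q + 1) ≤ q * (q + 1) := Nat.mul_le_mul_right _ (by omega)
    have h2 : q + 1 ≤ q * q := by nlinarith
    have h3 : q * (q + 1) ≤ q * (q * q) := Nat.mul_le_mul_left _ h2
    have h4 : q ^ 3 = q * (q * q) := by ring
    omega
  have b4 : 4 * q ^ (t + 3) ≤ q ^ (t + 4) := by rw [e4]; exact Nat.mul_le_mul_right _ hq4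
  have b5 : 4 * q ^ (t + 4) ≤ q ^ (t + 5) := by rw [e5]; exact Nat.mul_le_mul_right _ hq4
  have b5' : q ^ (t + 5) ≤ (t + 3) * q ^ (t + 5) := Nat.le_mul_of_pos_left _ (by omega)
  have b6 : 1 ≤ q ^ (t + 6) := Nat.one_le_pow _ _ (by omega)
  have b2 : 1 ≤ q ^ 2 := Nat.one_le_pow _ _ (by omega)
  apply final_aux (t + 6) q s hk hq4 hs2 F hF
  · simp only [show t + 6 - 1 = t + 5 by omega, show t + 6 - 2 = t + 4 by omega,
      show t + 6 - 3 = t + 3 by omega, show t + 6 - 5 = t + 1 by omega]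
    zify [show q ^ (t + 4) ≤ 2 * q ^ (t + 5) by omega, b6, b2,
      show 1 ≤ q ^ (t + 5) by omega, show 1 ≤ q ^ (t + 4) by omega, show 1 ≤ q by omega,
      show s * (q + 1) ≤ 2 * q ^ (t + 5) - q ^ (t + 4) + 1 + (t + 1) * θ by omega] at hθ ⊢
    have e5' : (q : ℤ) ^ (t + 5) = q * q ^ (t + 4) := by ring
    have e6' : (q : ℤ) ^ (t + 6) = q * (q * q ^ (t + 4)) := by ring
    rw [e6'] at hθ ⊢
    rw [e5']
    linear_combination (-(t : ℤ) - 1) * hθ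
  · simp only [show t + 6 - 1 = t + 5 by omega, show t + 6 - 2 = t + 4 by omega,
      show t + 6 - 3 = t + 3 by omega]
    zify [show 3 * q ^ (t + 4) ≤ (t + 3) * q ^ (t + 5) by omega, show 1 ≤ q by omega,
      show s * q ≤ (t + 3) * q ^ (t + 5) - 3 * q ^ (t + 4) + q ^ (t + 3) by omega]
    ring
  · omega
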